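/- arXiv:math/0006005 — 5 statements merged into one kernel-verified Lean document; each statement's English description precedes it below -/
import Mathlib

section
/- Every 2-cocycle α ∈ Z²(G,F*) is cohomologous to a normal cocycle; that is, there exists a map λ : G → F* with λ(1)=1 such that the cocycle β defined by β(x,y)=α(x,y)·λ(x)·λ(y)·λ(xy)⁻¹ satisfies β(x,g)=β(x g x⁻¹, x) for all x ∈ G and all β-regular g ∈ G. -/
/-- The coboundary modification of a cocycle `α` by `λ : G → F*`:
`β(x,y) = α(x,y)·λ(x)·λ(y)·λ(xy)⁻¹`. -/
def cobMod {G F : Type*} [Group G] [Field F] (α : G → G → Fˣ) (l : G → Fˣ) :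
    G → G → Fˣ :=
  fun x y => α x y * l x * l y * (l (x * y))⁻¹

/-- `g` is `β`-regular: `β(g,x) = β(x,g)` for all `x` in the centralizer of `g`. -/
def IsRegularElt {G F : Type*} [Group G] [Field F] (β : G → G → Fˣ) (g : G) : Prop :=
  ∀ x : G, x * g = g * x → β g x = β x g

/-- `β` is a normal cocycle: `β(x,g) = β(xgx⁻¹, x)` for all `x ∈ G` and all
`β`-regular `g ∈ G`. -/
def IsNormalCocycle {G F : Type*} [Group G] [Field F] (β : G → G → Fˣ) : Prop :=
  ∀ x g : G, IsRegularElt β g → β x g = β (x * g * x⁻¹) x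

/-- The scalar `f(x,g)` with `u_x u_g u_x⁻¹ = f(x,g) u_{xgx⁻¹}` in the twisted group algebra. -/
def conjFactor {G F : Type*} [Group G] [Field F] (α : G → G → Fˣ) (x g : G) : Fˣ :=
  α x g / α (x * g * x⁻¹) x

section

variable {G F : Type*} [Group G] [Field F] {α : G → G → Fˣ}

theorem conjFactor_mul
    (hαc : ∀ x y z : G, α x y * α (x * y) z = α y z * α x (y * z)) (x y g : G) :
    conjFactor α (x * y) g = conjFactor α x (y * g * y⁻¹) * conjFactor α y g := by
  have h1 := hαc x y g
  have h2 := hαc x (y * g * y⁻¹) y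
  have h3 := hαc (x * (y * g * y⁻¹) * x⁻¹) x y
  have hk : x * y * g * (x * y)⁻¹ = x * (y * g * y⁻¹) * x⁻¹ := by group
  rw [inv_mul_cancel_right] at h2 h3
  unfold conjFactor
  rw [hk, div_mul_div_comm, div_eq_div_iff_mul_eq_mul]
  refine mul_left_cancel (a := α x y * α (x * (y * g * y⁻¹)) y) ?_
  grind

theorem conjFactor_eq_one {g x : G} (hg : IsRegularElt α g) (hx : x * g = g * x) :
    conjFactor α x g = 1 := by
  rw [conjFactor, hx, mul_inv_cancel_right, hg x hx, div_self']

theorem IsRegularElt.conjFactor_eq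
    (hαc : ∀ x y z : G, α x y * α (x * y) z = α y z * α x (y * z)) {g s t : G}
    (hg : IsRegularElt α g) (h : s * g * s⁻¹ = t * g * t⁻¹) :
    conjFactor α s g = conjFactor α t g := by
  have hc : t⁻¹ * s * g = g * (t⁻¹ * s) := by
    calc t⁻¹ * s * g = t⁻¹ * (s * g * s⁻¹) * s := by group
      _ = g * (t⁻¹ * s) := by rw [h]; group
  have h1 := conjFactor_mul hαc t (t⁻¹ * s) g
  rwa [mul_inv_cancel_left, conjFactor_eq_one hg hc, hc, mul_inv_cancel_right, mul_one] at h1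

theorem IsRegularElt.conj
    (hαc : ∀ x y z : G, α x y * α (x * y) z = α y z * α x (y * z)) {g : G}
    (hg : IsRegularElt α g) (s : G) : IsRegularElt α (s * g * s⁻¹) := by
  intro c hc
  have hcs : c * s * g * (c * s)⁻¹ = s * g * s⁻¹ := by
    calc c * s * g * (c * s)⁻¹ = c * (s * g * s⁻¹) * c⁻¹ := by group
      _ = s * g * s⁻¹ := by rw [hc, mul_inv_cancel_right]
  have h1 := conjFactor_mul hαc c s g
  rw [hg.conjFactor_eq hαc hcs, eq_comm, mul_eq_right, conjFactor, hc,
    mul_inv_cancel_right, div_eq_one] at h1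
  exact h1.symm

theorem isRegularElt_cobMod {l : G → Fˣ} {g : G} :
    IsRegularElt (cobMod α l) g ↔ IsRegularElt α g := by
  refine forall₂_congr fun x hx => ?_
  simp only [cobMod, hx, mul_left_inj, mul_assoc, mul_comm (l x)]

theorem cobMod_eq_of_conjFactor {l : G → Fˣ} {x g : G}
    (h : l (x * g * x⁻¹) = conjFactor α x g * l g) :
    cobMod α l x g = cobMod α l (x * g * x⁻¹) x := by
  simp only [cobMod, h, conjFactor, inv_mul_cancel_right, mul_left_inj]
  rw [← mul_assoc, mul_div_cancel, mul_right_comm]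

end

/-- Every 2-cocycle `α ∈ Z²(G,F*)` is cohomologous to a normal cocycle: there is
`λ : G → F*` with `λ(1) = 1` such that `β(x,y) = α(x,y)·λ(x)·λ(y)·λ(xy)⁻¹` is normal. -/
theorem stmt4 {G F : Type*} [Group G] [Fintype G] [Field F] (α : G → G → Fˣ)
    (hα1 : ∀ x : G, α x 1 = 1) (hα1' : ∀ x : G, α 1 x = 1)
    (hαc : ∀ x y z : G, α x y * α (x * y) z = α y z * α x (y * z)) :
    ∃ l : G → Fˣ, l 1 = 1 ∧ IsNormalCocycle (cobMod α l) := by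
  have hrep (g : G) : ∃ t : G, t * (ConjClasses.mk g).out * t⁻¹ = g :=
    isConj_iff.mp (ConjClasses.mk_eq_mk_iff_isConj.mp (Quotient.out_eq (ConjClasses.mk g)))
  choose t ht using hrep
  refine ⟨fun g => conjFactor α (t g) (ConjClasses.mk g).out, ?_, ?_⟩
  · have h1 : (ConjClasses.mk (1 : G)).out = 1 := conj_eq_one_iff.mp (ht 1)
    simp [h1, conjFactor, hα1, hα1']
  · intro x g hg
    have hr : IsRegularElt α (ConjClasses.mk g).out := by
      have h := (isRegularElt_cobMod.mp hg).conj hαc (t g)⁻¹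
      have he : (t g)⁻¹ * g * (t g)⁻¹⁻¹ = (ConjClasses.mk g).out := by
        nth_rewrite 2 [← ht g]
        group
      rwa [he] at h
    apply cobMod_eq_of_conjFactor
    have hm : ConjClasses.mk (x * g * x⁻¹) = ConjClasses.mk g :=
      ConjClasses.mk_eq_mk_iff_isConj.mpr (isConj_iff.mpr ⟨x, rfl⟩).symm
    have hx := ht (x * g * x⁻¹)
    rw [hm] at hx
    have h2 := conjFactor_mul hαc x (t g) (ConjClasses.mk g).out
    rw [ht g] at h2
    rw [hm, ← h2]
    refine hr.conjFactor_eq hαc (hx.trans ?_)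
    nth_rewrite 1 [← ht g]
    group
end

section
/- The generalized twisted double A_α(G,S), i.e. the vector space C[G]⊗CS with product (g⊗e(s))·(h⊗e(t)) = α_t(g,h)·(gh ⊗ e(s·h)e(t)), is an associative algebra over C with identity element Σ_{t∈S} 1⊗e(t). -/
/-- The multiplication of the generalized twisted double `A_α(G,S)`, realized on the
space `(G × S) →₀ ℂ` of formal `ℂ`-linear combinations of the basis
`{g ⊗ e(s) : g ∈ G, s ∈ S}`:
`(g⊗e(s))·(h⊗e(t)) = α_t(g,h)·(gh ⊗ e(s·h)e(t))`, extended bilinearly.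
Here `act : S → G → S` is the right `G`-action on `S` and `α g h t` is `α_t(g,h)`. -/
noncomputable def gtdMul {G S : Type*} [Group G] [Fintype S] [DecidableEq S]
    (act : S → G → S) (α : G → G → S → ℂˣ)
    (a b : (G × S) →₀ ℂ) : (G × S) →₀ ℂ :=
  a.sum fun p c => b.sum fun q d =>
    if act p.2 q.1 = q.2 then
      Finsupp.single (p.1 * q.1, q.2) (c * d * (α p.1 q.1 q.2 : ℂ))
    else 0

section GtdMul

variable {G S : Type*} [Group G] [Fintype S] [DecidableEq S]
  (act : S → G → S) (α : G → G → S → ℂˣ)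

theorem gtdMul_zero_left (b : (G × S) →₀ ℂ) : gtdMul act α 0 b = 0 := by
  simp [gtdMul]

theorem gtdMul_zero_right (a : (G × S) →₀ ℂ) : gtdMul act α a 0 = 0 := by
  simp [gtdMul]

theorem gtdMul_add_left (a a' b : (G × S) →₀ ℂ) :
    gtdMul act α (a + a') b = gtdMul act α a b + gtdMul act α a' b := by
  unfold gtdMul
  refine Finsupp.sum_add_index' (fun p => ?_) (fun p c c' => ?_)
  · simp
  · rw [← Finsupp.sum_add]
    refine Finsupp.sum_congr fun q _ => ?_
    split_ifs
    · rw [← Finsupp.single_add, add_mul, add_mul]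
    · simp

theorem gtdMul_add_right (a b b' : (G × S) →₀ ℂ) :
    gtdMul act α a (b + b') = gtdMul act α a b + gtdMul act α a b' := by
  unfold gtdMul
  rw [← Finsupp.sum_add]
  refine Finsupp.sum_congr fun p _ => ?_
  refine Finsupp.sum_add_index' (fun q => ?_) (fun q d d' => ?_)
  · simp
  · split_ifs
    · rw [← Finsupp.single_add, mul_add, add_mul]
    · simp

theorem gtdMul_single_single (g h : G) (s t : S) (c d : ℂ) :
    gtdMul act α (Finsupp.single (g, s) c) (Finsupp.single (h, t) d) =
      if act s h = t then Finsupp.single (g * h, t) (c * d * (α g h t : ℂ)) else 0 := by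
  simp [gtdMul]

theorem gtdMul_sum_left {ι : Type*} (u : Finset ι) (f : ι → (G × S) →₀ ℂ)
    (b : (G × S) →₀ ℂ) :
    gtdMul act α (∑ i ∈ u, f i) b = ∑ i ∈ u, gtdMul act α (f i) b :=
  map_sum (AddMonoidHom.mk' (fun a => gtdMul act α a b)
    fun a a' => gtdMul_add_left act α a a' b) f u

theorem gtdMul_sum_right {ι : Type*} (u : Finset ι) (f : ι → (G × S) →₀ ℂ)
    (a : (G × S) →₀ ℂ) :
    gtdMul act α a (∑ i ∈ u, f i) = ∑ i ∈ u, gtdMul act α a (f i) :=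
  map_sum (AddMonoidHom.mk' (fun b => gtdMul act α a b)
    fun b b' => gtdMul_add_right act α a b b') f u

theorem gtdMul_assoc_single
    (hact1 : ∀ s : S, act s 1 = s)
    (hact : ∀ (s : S) (g h : G), act (act s g) h = act s (g * h))
    (hαc : ∀ (g h l : G) (s : S),
      α (g * h) l s * α g h (act s l⁻¹) = α g (h * l) s * α h l s)
    (g h l : G) (s t u : S) (c d e : ℂ) :
    gtdMul act α (gtdMul act α (Finsupp.single (g, s) c) (Finsupp.single (h, t) d))
        (Finsupp.single (l, u) e) =
      gtdMul act α (Finsupp.single (g, s) c)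
        (gtdMul act α (Finsupp.single (h, t) d) (Finsupp.single (l, u) e)) := by
  simp only [gtdMul_single_single]
  by_cases htu : act t l = u
  · have ht : t = act u l⁻¹ := by rw [← htu, hact, mul_inv_cancel, hact1]
    by_cases hst : act s h = t
    · have hsu : act s (h * l) = u := by rw [← hact, hst, htu]
      have key := congrArg Units.val (hαc g h l u)
      rw [← ht] at key
      simp only [Units.val_mul] at key
      simp only [if_pos htu, if_pos hst, if_pos hsu, gtdMul_single_single, mul_assoc g h l]
      congr 1
      linear_combination c * d * e * key
    · have hsu : act s (h * l) ≠ u := fun hsu => hst <| by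
        rw [ht, ← hsu, hact, mul_inv_cancel_right]
      simp only [if_pos htu, if_neg hst, if_neg hsu, gtdMul_single_single, gtdMul_zero_left]
  · rw [if_neg htu, gtdMul_zero_right]
    split_ifs
    · rw [gtdMul_single_single, if_neg htu]
    · exact gtdMul_zero_left act α _

end GtdMul

/-- The generalized twisted double `A_α(G,S)` is an associative `ℂ`-algebra with
identity element `∑_{t∈S} 1⊗e(t)`. -/
theorem stmt6 {G S : Type*} [Group G] [Fintype S] [DecidableEq S]
    (act : S → G → S)
    (hact1 : ∀ s : S, act s 1 = s)
    (hact : ∀ (s : S) (g h : G), act (act s g) h = act s (g * h))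
    (α : G → G → S → ℂˣ)
    (hα1 : ∀ (g : G) (s : S), α g 1 s = 1) (hα1' : ∀ (g : G) (s : S), α 1 g s = 1)
    (hαc : ∀ (g h l : G) (s : S),
      α (g * h) l s * α g h (act s l⁻¹) = α g (h * l) s * α h l s) :
    (∀ a b c : (G × S) →₀ ℂ,
        gtdMul act α (gtdMul act α a b) c = gtdMul act α a (gtdMul act α b c)) ∧
    (∀ a : (G × S) →₀ ℂ,
        gtdMul act α (∑ t : S, Finsupp.single ((1 : G), t) (1 : ℂ)) a = a ∧
        gtdMul act α a (∑ t : S, Finsupp.single ((1 : G), t) (1 : ℂ)) = a) := by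
  refine ⟨fun a b c => ?_, fun a => ⟨?_, ?_⟩⟩
  · induction a using Finsupp.induction_linear with
    | zero => simp only [gtdMul_zero_left]
    | add a a' ha ha' => simp only [gtdMul_add_left, ha, ha']
    | single p x =>
      induction b using Finsupp.induction_linear with
      | zero => simp only [gtdMul_zero_left, gtdMul_zero_right]
      | add b b' hb hb' => simp only [gtdMul_add_left, gtdMul_add_right, hb, hb']
      | single q y =>
        induction c using Finsupp.induction_linear with
        | zero => simp only [gtdMul_zero_right]
        | add c c' hc hc' => simp only [gtdMul_add_right, hc, hc']
        | single r z =>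
          exact gtdMul_assoc_single act α hact1 hact hαc p.1 q.1 r.1 p.2 q.2 r.2 x y z
  · induction a using Finsupp.induction_linear with
    | zero => exact gtdMul_zero_right act α _
    | add a a' ha ha' => rw [gtdMul_add_right, ha, ha']
    | single p x =>
      obtain ⟨g, s⟩ := p
      have hs : ∀ t : S, act t g = s ↔ t = act s g⁻¹ := fun t =>
        ⟨fun h => by rw [← h, hact, mul_inv_cancel, hact1],
          fun h => by rw [h, hact, inv_mul_cancel, hact1]⟩
      simp [gtdMul_sum_left, gtdMul_single_single, hs, hα1']
  · induction a using Finsupp.induction_linear with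
    | zero => exact gtdMul_zero_left act α _
    | add a a' ha ha' => rw [gtdMul_add_left, ha, ha']
    | single p x =>
      obtain ⟨g, s⟩ := p
      simp [gtdMul_sum_right, gtdMul_single_single, hact1, hα1]
end

section
/- For each s ∈ S, the subspace N(s) = span{a⊗e(s) : a ∈ G∖G_s} is a two-sided nilpotent ideal of D(s) = span{a⊗e(s) : a ∈ G}, and moreover D(s)·N(s) = 0. -/
/-- Elements of the span of basis vectors indexed by a set are supported on that set. -/
theorem Finsupp.mem_of_mem_support_of_mem_span_single {R ι : Type*} [Semiring R] {P : Set ι}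
    {V : Set (ι →₀ R)} (hV : ∀ v ∈ V, ∃ i ∈ P, v = Finsupp.single i 1) {x : ι →₀ R}
    (hx : x ∈ Submodule.span R V) {i : ι} (hi : i ∈ x.support) : i ∈ P := by
  have hle : Submodule.span R V ≤ Finsupp.supported R R P := by
    refine Submodule.span_le.2 fun v hv => ?_
    obtain ⟨j, hj, rfl⟩ := hV v hv
    exact Finsupp.single_mem_supported R 1 hj
  exact (Finsupp.mem_supported R x).1 (hle hx) hi

/-- For each `s ∈ S`, the subspace `N(s) = span{a⊗e(s) : a ∈ G∖G_s}` is a two-sided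
nilpotent ideal of `D(s) = span{a⊗e(s) : a ∈ G}`, and moreover `D(s)·N(s) = 0`. -/
theorem stmt9 {G S : Type*} [Group G] [Fintype S] [DecidableEq S]
    (act : S → G → S)
    (hact1 : ∀ s : S, act s 1 = s)
    (hact : ∀ (s : S) (g h : G), act (act s g) h = act s (g * h))
    (α : G → G → S → ℂˣ)
    (hα1 : ∀ (g : G) (s : S), α g 1 s = 1) (hα1' : ∀ (g : G) (s : S), α 1 g s = 1)
    (hαc : ∀ (g h l : G) (s : S),
      α (g * h) l s * α g h (act s l⁻¹) = α g (h * l) s * α h l s)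
    (s : S) :
    ∀ Ds Ns : Submodule ℂ ((G × S) →₀ ℂ),
      Ds = Submodule.span ℂ
          {v : (G × S) →₀ ℂ | ∃ a : G, v = Finsupp.single (a, s) (1 : ℂ)} →
      Ns = Submodule.span ℂ
          {v : (G × S) →₀ ℂ | ∃ a : G, act s a ≠ s ∧ v = Finsupp.single (a, s) (1 : ℂ)} →
      -- `D(s)·N(s) = 0` (in particular `N(s)` is a left ideal of `D(s)`)
      (∀ x ∈ Ds, ∀ y ∈ Ns, gtdMul act α x y = 0) ∧
      -- `N(s)` is a right ideal of `D(s)`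
      (∀ x ∈ Ns, ∀ y ∈ Ds, gtdMul act α x y ∈ Ns) ∧
      -- `N(s)` is nilpotent: `N(s)² = 0`
      (∀ x ∈ Ns, ∀ y ∈ Ns, gtdMul act α x y = 0) := by
  rintro Ds Ns rfl rfl
  have hD : ∀ x ∈ Submodule.span ℂ
      {v : (G × S) →₀ ℂ | ∃ a : G, v = Finsupp.single (a, s) (1 : ℂ)},
      ∀ p ∈ x.support, p.2 = s := fun x hx p hp =>
    Finsupp.mem_of_mem_support_of_mem_span_single (P := {p : G × S | p.2 = s})
      (by rintro v ⟨a, rfl⟩; exact ⟨(a, s), rfl, rfl⟩) hx hp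
  have hN : ∀ x ∈ Submodule.span ℂ
      {v : (G × S) →₀ ℂ | ∃ a : G, act s a ≠ s ∧ v = Finsupp.single (a, s) (1 : ℂ)},
      ∀ p ∈ x.support, p.2 = s ∧ act s p.1 ≠ s := fun x hx p hp =>
    Finsupp.mem_of_mem_support_of_mem_span_single (P := {p : G × S | p.2 = s ∧ act s p.1 ≠ s})
      (by rintro v ⟨a, ha, rfl⟩; exact ⟨(a, s), ⟨rfl, ha⟩, rfl⟩) hx hp
  have hzero : ∀ x y : (G × S) →₀ ℂ, (∀ p ∈ x.support, p.2 = s) →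
      (∀ q ∈ y.support, q.2 = s ∧ act s q.1 ≠ s) → gtdMul act α x y = 0 := by
    intro x y hx hy
    refine Finset.sum_eq_zero fun p hp => Finset.sum_eq_zero fun q hq => if_neg ?_
    rw [hx p hp, (hy q hq).1]
    exact (hy q hq).2
  refine ⟨fun x hx y hy => hzero x y (hD x hx) (hN y hy), fun x hx y hy => ?_,
    fun x hx y hy => hzero x y (fun p hp => (hN x hx p hp).1) (hN y hy)⟩
  refine Submodule.sum_mem _ fun p hp => Submodule.sum_mem _ fun q hq => ?_
  obtain ⟨hp1, hp2⟩ := hN x hx p hp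
  have hq1 := hD y hy q hq
  dsimp only
  split_ifs with h
  · rw [hp1, hq1] at h
    have hne : act s (p.1 * q.1) ≠ s := by
      intro hs
      apply hp2
      calc act s p.1 = act (act s (p.1 * q.1)) q.1⁻¹ := by rw [hact, mul_inv_cancel_right]
        _ = act (act s q.1) q.1⁻¹ := by rw [hs, h]
        _ = s := by rw [hact, mul_inv_cancel, hact1]
    rw [hq1, ← Finsupp.smul_single_one]
    exact Submodule.smul_mem _ _ (Submodule.subset_span ⟨_, hne, rfl⟩)
  · exact Submodule.zero_mem _
end

section
/- Let s ∈ S, let O_s be the G-orbit of s, and let G = ∪_{i=1}^k G_s g_i be a right coset decomposition, so O_s = {s·g_i : i=1,...,k}. Then D(O_s) = span{a⊗e(t) : a ∈ G, t ∈ O_s} decomposes as the direct sum ⊕_{i=1}^k D(s·g_i) of left ideals, D(O_s) is a two-sided ideal of A_α(G,S) whose identity element is Σ_{t∈O_s} 1⊗e(t), and if S = ∪_{j∈J} O_{s_j} is the decomposition of S into disjoint G-orbits, then A_α(G,S) = ⊕_{j∈J} D(O_{s_j}). -/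
/-- `D(t) = span{a⊗e(t) : a ∈ G}`. -/
noncomputable def Dspan {G S : Type*} [Group G] [Fintype S] (t : S) :
    Submodule ℂ ((G × S) →₀ ℂ) :=
  Submodule.span ℂ {v : (G × S) →₀ ℂ | ∃ a : G, v = Finsupp.single (a, t) (1 : ℂ)}

/-- `D(O_s) = span{a⊗e(t) : a ∈ G, t ∈ O_s}`, where `O_s` is the `G`-orbit of `s`. -/
noncomputable def DOspan {G S : Type*} [Group G] [Fintype S] (act : S → G → S) (s : S) :
    Submodule ℂ ((G × S) →₀ ℂ) :=
  Submodule.span ℂ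
    {v : (G × S) →₀ ℂ | ∃ a x : G, v = Finsupp.single (a, act s x) (1 : ℂ)}

theorem disjoint_supported_iSup_ne {X ι : Type*} {T : ι → Set X}
    (hT : Pairwise fun i j => Disjoint (T i) (T j)) (i : ι) :
    Disjoint (Finsupp.supported ℂ ℂ (T i)) (⨆ j, ⨆ _ : j ≠ i, Finsupp.supported ℂ ℂ (T j)) := by
  have h : Disjoint (T i) (T i)ᶜ := disjoint_compl_right
  refine (Finsupp.disjoint_supported_supported h).mono_right (iSup₂_le fun j hj => ?_)
  exact Finsupp.supported_mono (hT hj).subset_compl_right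

theorem Dspan_eq_supported {G S : Type*} [Group G] [Fintype S] (t : S) :
    Dspan (G := G) t = Finsupp.supported ℂ ℂ {p : G × S | p.2 = t} := by
  rw [Finsupp.supported_eq_span_single, Dspan]
  congr 1
  ext v
  constructor
  · rintro ⟨a, rfl⟩
    exact ⟨(a, t), rfl, rfl⟩
  · rintro ⟨⟨a, _⟩, rfl, rfl⟩
    exact ⟨a, rfl⟩

theorem DOspan_eq_supported {G S : Type*} [Group G] [Fintype S] (act : S → G → S) (s : S) :
    DOspan act s = Finsupp.supported ℂ ℂ {p : G × S | ∃ x, act s x = p.2} := by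
  rw [Finsupp.supported_eq_span_single, DOspan]
  congr 1
  ext v
  constructor
  · rintro ⟨a, x, rfl⟩
    exact ⟨(a, act s x), ⟨x, rfl⟩, rfl⟩
  · rintro ⟨⟨a, _⟩, ⟨x, rfl⟩, rfl⟩
    exact ⟨a, x, rfl⟩

/-- A product lies in a submodule as soon as all the products of basis elements in the
supports of its factors do. -/
theorem gtdMul_mem {G S : Type*} [Group G] [Fintype S] [DecidableEq S]
    (act : S → G → S) (α : G → G → S → ℂˣ) (a b : (G × S) →₀ ℂ) (T : Set (G × S))
    (h : ∀ p ∈ a.support, ∀ q ∈ b.support, act p.2 q.1 = q.2 → (p.1 * q.1, q.2) ∈ T) :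
    gtdMul act α a b ∈ Finsupp.supported ℂ ℂ T := by
  refine Submodule.sum_mem _ fun p hp => Submodule.sum_mem _ fun q hq => ?_
  dsimp only
  split_ifs with hpq
  · exact Finsupp.single_mem_supported ℂ _ (h p hp q hq hpq)
  · exact Submodule.zero_mem _

theorem gtdMul_sum_single_one {G S ι : Type*} [Group G] [Fintype S] [DecidableEq S] [Fintype ι]
    (act : S → G → S) (α : G → G → S → ℂˣ) (hact1 : ∀ s, act s 1 = s)
    (hα1 : ∀ g s, α g 1 s = 1) (t : ι → S) (y : (G × S) →₀ ℂ)
    (hy : ∀ p ∈ y.support, ∃! i, p.2 = t i) :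
    gtdMul act α y (∑ i, Finsupp.single ((1 : G), t i) (1 : ℂ)) = y := by
  classical
  conv_rhs => rw [← Finsupp.sum_single y]
  refine Finset.sum_congr rfl fun p hp => ?_
  obtain ⟨i, hi, hu⟩ := hy p hp
  dsimp only
  rw [← Finsupp.sum_finsetSum_index (by simp)
    (by intros; split_ifs <;> simp [mul_add, add_mul])]
  rw [Finset.sum_congr rfl fun i _ => Finsupp.sum_single_index (by simp)]
  simp only [hact1]
  rw [Finset.sum_eq_single i]
  · simp [hi.symm, hα1]
  · intro j _ hj
    have : p.2 ≠ t j := fun h => hj (hu j h)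
    simp [this]
  · simp

theorem sum_single_one_gtdMul {G S ι : Type*} [Group G] [Fintype S] [DecidableEq S] [Fintype ι]
    (act : S → G → S) (α : G → G → S → ℂˣ) (hα1 : ∀ g s, α 1 g s = 1)
    (t : ι → S) (y : (G × S) →₀ ℂ)
    (hy : ∀ q ∈ y.support, ∃! i, act (t i) q.1 = q.2) :
    gtdMul act α (∑ i, Finsupp.single ((1 : G), t i) (1 : ℂ)) y = y := by
  classical
  rw [gtdMul, ← Finsupp.sum_finsetSum_index (by simp) (by
    intro p c c'
    rw [← Finsupp.sum_add]
    refine Finsupp.sum_congr fun q _ => ?_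
    split_ifs <;> simp [add_mul])]
  conv_rhs => rw [← Finsupp.sum_single y]
  rw [Finset.sum_congr rfl fun i _ => Finsupp.sum_single_index (by simp)]
  simp only [Finsupp.sum]
  rw [Finset.sum_comm]
  refine Finset.sum_congr rfl fun q hq => ?_
  obtain ⟨i, hi, hu⟩ := hy q hq
  rw [Finset.sum_eq_single i]
  · simp [hi, hα1]
  · intro j _ hj
    exact if_neg fun h => hj (hu j h)
  · simp

/-- Let `s ∈ S` and `G = ∪_{i=1}^k G_s g_i` a right coset decomposition, so that
`O_s = {s·g_i}`.  Then `D(O_s) = ⊕_i D(s·g_i)` is a direct sum of left ideals of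
`A_α(G,S)`, `D(O_s)` is a two-sided ideal with identity element `∑_{t∈O_s} 1⊗e(t)`,
and if `S = ∪_{j∈J} O_{s_j}` is the orbit decomposition then
`A_α(G,S) = ⊕_{j∈J} D(O_{s_j})`. -/
theorem stmt10 {G S : Type*} [Group G] [Fintype S] [DecidableEq S]
    (act : S → G → S)
    (hact1 : ∀ s : S, act s 1 = s)
    (hact : ∀ (s : S) (g h : G), act (act s g) h = act s (g * h))
    (α : G → G → S → ℂˣ)
    (hα1 : ∀ (g : G) (s : S), α g 1 s = 1) (hα1' : ∀ (g : G) (s : S), α 1 g s = 1)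
    (hαc : ∀ (g h l : G) (s : S),
      α (g * h) l s * α g h (act s l⁻¹) = α g (h * l) s * α h l s)
    (s : S) (k : ℕ) (g : Fin k → G)
    (hcoset : ∀ x : G, ∃! i : Fin k, act s x = act s (g i))
    {J : Type*} [Fintype J] (sj : J → S)
    (horb : ∀ t : S, ∃! j : J, ∃ x : G, act (sj j) x = t) :
    -- `D(O_s)` is the direct sum of the left ideals `D(s·g_i)`
    DOspan act s = (⨆ i : Fin k, Dspan (G := G) (act s (g i))) ∧
    (∀ i : Fin k,
      Disjoint (Dspan (G := G) (act s (g i)))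
        (⨆ j : Fin k, ⨆ _ : j ≠ i, Dspan (G := G) (act s (g j)))) ∧
    (∀ i : Fin k, ∀ x : (G × S) →₀ ℂ, ∀ y ∈ Dspan (G := G) (act s (g i)),
      gtdMul act α x y ∈ Dspan (G := G) (act s (g i))) ∧
    -- `D(O_s)` is a two-sided ideal of `A_α(G,S)`
    (∀ x : (G × S) →₀ ℂ, ∀ y ∈ DOspan act s,
      gtdMul act α x y ∈ DOspan act s ∧ gtdMul act α y x ∈ DOspan act s) ∧
    -- with identity element `∑_{t ∈ O_s} 1⊗e(t)`
    (∀ y ∈ DOspan act s,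
      gtdMul act α (∑ i : Fin k, Finsupp.single ((1 : G), act s (g i)) (1 : ℂ)) y = y ∧
      gtdMul act α y (∑ i : Fin k, Finsupp.single ((1 : G), act s (g i)) (1 : ℂ)) = y) ∧
    -- `A_α(G,S) = ⊕_{j∈J} D(O_{s_j})`
    (⨆ j : J, DOspan act (sj j)) = (⊤ : Submodule ℂ ((G × S) →₀ ℂ)) ∧
    (∀ j : J,
      Disjoint (DOspan act (sj j)) (⨆ j' : J, ⨆ _ : j' ≠ j, DOspan act (sj j'))) := by
  have hdisj : Pairwise fun i j : Fin k => act s (g i) ≠ act s (g j) := fun i j hij h =>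
    hij ((hcoset (g i)).unique rfl h)
  have horbit : ∀ j j' : J, ∀ x x' : G, act (sj j) x = act (sj j') x' → j = j' :=
    fun j j' x x' h => (horb (act (sj j) x)).unique ⟨x, rfl⟩ ⟨x', h.symm⟩
  simp only [Dspan_eq_supported, DOspan_eq_supported, ← Finsupp.supported_iUnion]
  refine ⟨?_, fun i => ?_, fun i x y hy => ?_, fun x y hy => ⟨?_, ?_⟩, fun y hy => ⟨?_, ?_⟩, ?_,
    fun j => ?_⟩
  · congr 1
    ext p
    simp only [Set.mem_ofPred_eq, Set.mem_iUnion]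
    constructor
    · rintro ⟨x, hx⟩
      obtain ⟨i, hi, -⟩ := hcoset x
      exact ⟨i, hx.symm.trans hi⟩
    · rintro ⟨i, hi⟩
      exact ⟨g i, hi.symm⟩
  · refine disjoint_supported_iSup_ne (T := fun i => {p : G × S | p.2 = act s (g i)}) ?_ i
    exact fun i j hij => Set.disjoint_left.2 fun p hi hj => hdisj hij (hi.symm.trans hj)
  · exact gtdMul_mem act α x y _ fun p _ q hq _ => by simpa using hy hq
  · exact gtdMul_mem act α x y _ fun p _ q hq _ => by simpa using hy hq
  · refine gtdMul_mem act α y x _ fun p hp q _ hpq => ?_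
    obtain ⟨z, hz⟩ := hy hp
    exact ⟨z * q.1, by rw [← hact, hz, hpq]⟩
  · refine sum_single_one_gtdMul act α hα1' _ y fun q hq => ?_
    obtain ⟨z, hz⟩ := hy hq
    obtain ⟨i, hi, hu⟩ := hcoset (z * q.1⁻¹)
    refine ⟨i, ?_, fun j hj => hu j ?_⟩
    · dsimp only
      rw [← hi, hact, inv_mul_cancel_right, hz]
    · dsimp only at hj ⊢
      rw [← hact, hz, ← hj, hact, hact, mul_inv_cancel, mul_one]
  · refine gtdMul_sum_single_one act α hact1 hα1 _ y fun p hp => ?_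
    obtain ⟨z, hz⟩ := hy hp
    simpa only [hz] using hcoset z
  · rw [← Finsupp.supported_univ]
    congr 1
    refine Set.eq_univ_of_forall fun p => Set.mem_iUnion.2 ?_
    exact (horb p.2).exists
  · refine disjoint_supported_iSup_ne
      (T := fun j => {p : G × S | ∃ x, act (sj j) x = p.2}) ?_ j
    exact fun i j hij => Set.disjoint_left.2 fun p ⟨x, hx⟩ ⟨x', hx'⟩ =>
      hij (horbit _ _ _ _ (hx.trans hx'.symm))
end

section
/- Fix s ∈ S and a right coset decomposition G = ∪_{i=1}^k G_s g_i with g_1 = 1. Assume each α_t (t ∈ S) restricted to G_t is a normal cocycle, and assume α_{s g_i}(g_j⁻¹ h g_i, g_i⁻¹ a g_i) = α_{s g_i}(g_j⁻¹ h a h⁻¹ g_j, g_j⁻¹ h g_i) for all 1 ≤ i,j ≤ k, all h ∈ G_s and all α_s-regular a ∈ G_s. Then for any α_s-regular conjugacy class L of G_s, the element Z(L) = Σ_{a∈L} Σ_{i=1}^k (g_i⁻¹ a g_i) ⊗ e(s·g_i) lies in the center of the algebra D(O_s). -/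
/-- `a` in the stabilizer `G_t` is `α_t`-regular: `α_t(a,x) = α_t(x,a)` for all `x` in
the centralizer of `a` in `G_t`. -/
def IsRegAt {G S : Type*} [Group G] (act : S → G → S) (α : G → G → S → ℂˣ)
    (t : S) (a : G) : Prop :=
  ∀ z : G, act t z = t → z * a = a * z → α a z t = α z a t

/-- The product `gtdMul` as a bilinear map. -/
noncomputable def gtdMulBilin {G S : Type*} [Group G] [Fintype S] [DecidableEq S]
    (act : S → G → S) (α : G → G → S → ℂˣ) :
    ((G × S) →₀ ℂ) →ₗ[ℂ] ((G × S) →₀ ℂ) →ₗ[ℂ] ((G × S) →₀ ℂ) :=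
  Finsupp.lsum ℂ fun p => LinearMap.flip <| Finsupp.lsum ℂ fun q =>
    if act p.2 q.1 = q.2 then
      LinearMap.mk₂ ℂ (fun d c : ℂ =>
          Finsupp.single (p.1 * q.1, q.2) (c * d * (α p.1 q.1 q.2 : ℂ)))
        (fun _ _ _ => by rw [← Finsupp.single_add]; congr 1; ring)
        (fun _ _ _ => by rw [Finsupp.smul_single, smul_eq_mul, smul_eq_mul]; congr 1; ring)
        (fun _ _ _ => by rw [← Finsupp.single_add]; congr 1; ring)
        (fun _ _ _ => by rw [Finsupp.smul_single, smul_eq_mul, smul_eq_mul]; congr 1; ring)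
    else 0

theorem gtdMul_eq_gtdMulBilin {G S : Type*} [Group G] [Fintype S] [DecidableEq S]
    (act : S → G → S) (α : G → G → S → ℂˣ) (a b : (G × S) →₀ ℂ) :
    gtdMul act α a b = gtdMulBilin act α a b := by
  simp only [gtdMul, gtdMulBilin, Finsupp.lsum_apply, Finsupp.sum, LinearMap.sum_apply,
    LinearMap.flip_apply]
  refine Finset.sum_congr rfl fun p _ => Finset.sum_congr rfl fun q _ => ?_
  split_ifs <;> simp

theorem gtdMulBilin_single {G S : Type*} [Group G] [Fintype S] [DecidableEq S]
    (act : S → G → S) (α : G → G → S → ℂˣ) (x y : G) (t u : S) :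
    gtdMulBilin act α (Finsupp.single (x, t) 1) (Finsupp.single (y, u) 1) =
      if act t y = u then Finsupp.single (x * y, u) (α x y u : ℂ) else 0 := by
  rw [← gtdMul_eq_gtdMulBilin, gtdMul, Finsupp.sum_single_index (by simp),
    Finsupp.sum_single_index (by simp)]
  simp only [mul_one, one_mul]

/-- Fix `s ∈ S` and a right coset decomposition `G = ∪_{i=1}^k G_s g_i` with `g_1 = 1`.
Assume each `α_t` restricted to `G_t` is a normal cocycle, and the compatibility
condition `α_{s g_i}(g_j⁻¹ h g_i, g_i⁻¹ a g_i) = α_{s g_i}(g_j⁻¹ h a h⁻¹ g_j, g_j⁻¹ h g_i)`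
for all `i,j`, all `h ∈ G_s` and all `α_s`-regular `a ∈ G_s`.  Then for any `α_s`-regular
conjugacy class `L` of `G_s`, the element
`Z(L) = ∑_{a∈L} ∑_{i=1}^k (g_i⁻¹ a g_i) ⊗ e(s·g_i)` lies in the center of `D(O_s)`. -/
theorem stmt14 {G S : Type*} [Group G] [Fintype S] [DecidableEq S]
    (act : S → G → S)
    (hact1 : ∀ s : S, act s 1 = s)
    (hact : ∀ (s : S) (g h : G), act (act s g) h = act s (g * h))
    (α : G → G → S → ℂˣ)
    (hα1 : ∀ (g : G) (s : S), α g 1 s = 1) (hα1' : ∀ (g : G) (s : S), α 1 g s = 1)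
    (hαc : ∀ (g h l : G) (s : S),
      α (g * h) l s * α g h (act s l⁻¹) = α g (h * l) s * α h l s)
    (s : S) (k : ℕ) [NeZero k] (g : Fin k → G) (hg1 : g 0 = 1)
    (hcoset : ∀ x : G, ∃! i : Fin k, act s x = act s (g i))
    -- each `α_t` restricted to the stabilizer `G_t` is a normal cocycle
    (hnorm : ∀ (t : S) (x a : G), act t x = t → act t a = t → IsRegAt act α t a →
      α x a t = α (x * a * x⁻¹) x t)
    -- the compatibility condition
    (hcompat : ∀ (i j : Fin k) (h a : G), act s h = s → act s a = s →
      IsRegAt act α s a →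
      α ((g j)⁻¹ * h * g i) ((g i)⁻¹ * a * g i) (act s (g i))
        = α ((g j)⁻¹ * (h * a * h⁻¹) * g j) ((g j)⁻¹ * h * g i) (act s (g i)))
    -- `L` is an `α_s`-regular conjugacy class of `G_s`
    (L : Finset G)
    (hLs : ∀ a ∈ L, act s a = s)
    (hLreg : ∀ a ∈ L, IsRegAt act α s a)
    (hLconj : ∃ a₀ ∈ L, ∀ b : G,
      b ∈ L ↔ ∃ h : G, act s h = s ∧ b = h * a₀ * h⁻¹) :
    -- `Z(L)` lies in `D(O_s)` and commutes with every element of `D(O_s)`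
    (∑ a ∈ L, ∑ i : Fin k,
        Finsupp.single ((g i)⁻¹ * a * g i, act s (g i)) (1 : ℂ)) ∈
      Submodule.span ℂ
        {v : (G × S) →₀ ℂ | ∃ a x : G, v = Finsupp.single (a, act s x) (1 : ℂ)} ∧
    ∀ w ∈ Submodule.span ℂ
        {v : (G × S) →₀ ℂ | ∃ a x : G, v = Finsupp.single (a, act s x) (1 : ℂ)},
      gtdMul act α w
          (∑ a ∈ L, ∑ i : Fin k,
            Finsupp.single ((g i)⁻¹ * a * g i, act s (g i)) (1 : ℂ))
        = gtdMul act α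
            (∑ a ∈ L, ∑ i : Fin k,
              Finsupp.single ((g i)⁻¹ * a * g i, act s (g i)) (1 : ℂ)) w := by
  have hcancel : ∀ {t u : S} (x : G), act t x = act u x → t = u := fun {t u} x h => by
    simpa [hact, hact1] using congrArg (act · x⁻¹) h
  refine ⟨Submodule.sum_mem _ fun a _ => Submodule.sum_mem _ fun i _ =>
    Submodule.subset_span ⟨_, _, rfl⟩, fun w hw => ?_⟩
  simp only [gtdMul_eq_gtdMulBilin]
  induction hw using Submodule.span_induction with
  | zero => simp
  | add v w _ _ hv hw => rw [map_add, LinearMap.add_apply, hv, hw, map_add]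
  | smul c v _ hv => rw [map_smul, LinearMap.smul_apply, hv, map_smul]
  | mem v hv =>
    obtain ⟨x, y, rfl⟩ := hv
    obtain ⟨i, hi, -⟩ := hcoset y
    obtain ⟨j, hj, hj_unique⟩ := hcoset (g i * x⁻¹)
    have hj' : act (act s (g j)) x = act s (g i) := by
      rw [← hj, hact, inv_mul_cancel_right]
    rw [hi]
    simp only [map_sum, LinearMap.sum_apply, gtdMulBilin_single]
    have hleft : ∀ a ∈ L, ∀ l : Fin k,
        act (act s (g i)) ((g l)⁻¹ * a * g l) = act s (g l) ↔ l = i := by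
      intro a ha l
      have hfix : act (act s (g l)) ((g l)⁻¹ * a * g l) = act s (g l) := by
        rw [hact, show g l * ((g l)⁻¹ * a * g l) = a * g l by group, ← hact, hLs a ha]
      refine ⟨fun h => ?_, fun h => h ▸ hfix⟩
      exact (hcoset (g i)).unique (hcancel _ (h.trans hfix.symm)) rfl
    have hright : ∀ l : Fin k, act (act s (g l)) x = act s (g i) ↔ l = j := by
      refine fun l => ⟨fun h => hj_unique l ?_, fun h => h ▸ hj'⟩
      exact hj.trans (hcancel x (hj'.trans h.symm))
    obtain ⟨h, hh⟩ : ∃ h, h = g j * x * (g i)⁻¹ := ⟨_, rfl⟩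
    have hhs : act s h = s := by
      rw [hh, ← hact, ← hact, hj', hact, mul_inv_cancel, hact1]
    have hhs' : act s h⁻¹ = s := by
      simpa [hact, hact1] using (congrArg (act · h⁻¹) hhs).symm
    have hx : x = (g j)⁻¹ * h * g i := by rw [hh]; group
    have hLclosed : ∀ u a : G, act s u = s → a ∈ L → u * a * u⁻¹ ∈ L := by
      obtain ⟨a₀, -, hL⟩ := hLconj
      intro u a hu ha
      obtain ⟨z, hz, rfl⟩ := (hL a).1 ha
      exact (hL _).2 ⟨u * z, by rw [← hact, hu, hz], by group⟩
    have hlhs : ∀ a ∈ L, (∑ l : Fin k,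
        if act (act s (g i)) ((g l)⁻¹ * a * g l) = act s (g l) then
          Finsupp.single (x * ((g l)⁻¹ * a * g l), act s (g l))
            (α x ((g l)⁻¹ * a * g l) (act s (g l)) : ℂ) else 0) =
        Finsupp.single (x * ((g i)⁻¹ * a * g i), act s (g i))
          (α x ((g i)⁻¹ * a * g i) (act s (g i)) : ℂ) := by
      intro a ha
      simp [hleft a ha]
    rw [Finset.sum_congr rfl hlhs]
    simp only [hright, Finset.sum_ite_eq', Finset.mem_univ, if_true]
    refine Finset.sum_bij' (fun a _ => h * a * h⁻¹) (fun a _ => h⁻¹ * a * h)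
      (fun a ha => hLclosed h a hhs ha)
      (fun a ha => by simpa using hLclosed h⁻¹ a hhs' ha)
      (fun a _ => by group) (fun a _ => by group) fun a ha => ?_
    have hc := hcompat i j h a hhs (hLs a ha) (hLreg a ha)
    rw [← hx] at hc
    rw [hc, show x * ((g i)⁻¹ * a * g i) = (g j)⁻¹ * (h * a * h⁻¹) * g j * x by
      rw [hx]; group]
end
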